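/- arXiv:2408.01212 — 2 statements merged into one kernel-verified Lean document; each statement's English description precedes it below -/
import Mathlib

section
/- Let Γ = (S, Act, P) be a finite MDP with a parity objective φ and target sets F_1, …, F_n ⊆ S such that every state of F = F_1 ∪ ⋯ ∪ F_n is a sink, and suppose that for every state s' ∈ S there exists a strategy σ' with Γ, σ', s' ⊨ S(φ) ∧ Pr_{≥1}(◇F). Then for every state s, every strategy τ, and every ε > 0, there exists a finite-memory strategy σ such that Γ, σ, s ⊨ S(φ) ∧ Pr_{≥1}(◇F) and Pr^{Γ^σ}_{(s,q_ι)}(◇F_i) ≥ Pr^{Γ^τ}_{(s,q_ι^τ)}(◇F_i) − ε for every i ∈ {1,…,n}. (Switching lemma from the proof of Lemma 8: play τ for sufficiently many steps, then switch to a strategy surely satisfying φ and almost-surely reaching F.) -/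
open MeasureTheory ENNReal
open scoped Classical

/-! ### Markov chains on countable state spaces and their path measures -/

/-- The product σ-algebra on infinite paths over a (discrete) state space `T`. -/
noncomputable def pathsMS (T : Type*) : MeasurableSpace (ℕ → T) :=
  @MeasurableSpace.pi ℕ (fun _ => T) (fun _ => ⊤)

/-- The cylinder set of all paths agreeing with `π` on the first `k+1` states. -/
def Cyl {T : Type*} (π : ℕ → T) (k : ℕ) : Set (ℕ → T) := {ω | ∀ i ≤ k, ω i = π i}

/-- `μ` is the path measure of the Markov chain with transition probabilities `P`
and initial state `s`: it is a probability measure assigning to each cylinder set the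
product of the transition probabilities along its prefix. -/
def IsPathMeasure {T : Type*} (P : T → T → ℝ≥0∞) (s : T)
    (μ : @Measure (ℕ → T) (pathsMS T)) : Prop :=
  μ Set.univ = 1 ∧
  ∀ (π : ℕ → T) (k : ℕ),
    μ (Cyl π k) = if π 0 = s then ∏ i ∈ Finset.range k, P (π i) (π (i + 1)) else 0

/-- The path measure `Pr^M_s` of a Markov chain (it exists and is unique by the
Ionescu–Tulcea/Carathéodory theorems; here it is taken by definite description). -/
noncomputable def pathMeasure {T : Type*} (P : T → T → ℝ≥0∞) (s : T) :
    @Measure (ℕ → T) (pathsMS T) :=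
  if h : ∃ μ, IsPathMeasure P s μ then h.choose else 0

/-- `Paths^M_s`: infinite sequences starting at `s` all of whose steps have positive
transition probability. -/
def PathsFrom {T : Type*} (P : T → T → ℝ≥0∞) (s : T) : Set (ℕ → T) :=
  {ω | ω 0 = s ∧ ∀ i, 0 < P (ω i) (ω (i + 1))}

/-! ### MDPs, strategies, objectives -/

/-- A finite Markov decision process: transition probabilities `P s a s'` such that
for each state-action pair the total mass is `0` or `1` (the action is *enabled* at `s`
in the latter case), and every state has an enabled action. -/
structure MDP (S Act : Type) [Fintype S] [Nonempty S] [Fintype Act] [Nonempty Act] where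
  P : S → Act → S → ℝ≥0∞
  sum_mem : ∀ s a, (∑ s', P s a s') = 0 ∨ (∑ s', P s a s') = 1
  exists_enabled : ∀ s, ∃ a, (∑ s', P s a s') = 1

variable {S Act : Type} [Fintype S] [Nonempty S] [Fintype Act] [Nonempty Act]

/-- A strategy: a machine with countable memory `Q`, initial mode `init`,
deterministic memory update `next`, and output distributions `out` supported on
enabled actions. -/
structure Strategy (M : MDP S Act) where
  Q : Type
  countable : Countable Q
  init : Q
  next : Q → S → Q
  out : Q → S → Act → ℝ≥0∞
  out_sum : ∀ q s, (∑ a, out q s a) = 1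
  out_enabled : ∀ q s a, out q s a ≠ 0 → (∑ s', M.P s a s') = 1

/-- A strategy is finite-memory if its memory set is finite. -/
def Strategy.FiniteMemory {M : MDP S Act} (σ : Strategy M) : Prop := Finite σ.Q

/-- The transition probabilities of the Markov chain `Γ^σ` induced by strategy `σ`
on the state space `S × Q`. -/
noncomputable def MDP.step (M : MDP S Act) (σ : Strategy M) : S × σ.Q → S × σ.Q → ℝ≥0∞ :=
  fun x y => if σ.next x.2 x.1 = y.2 then ∑ a, σ.out x.2 x.1 a * M.P x.1 a y.1 else 0

/-- Lifting an objective over `S` to paths over `S × Q` via the first component. -/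
def liftObj {T Q : Type*} (Ω : Set (ℕ → T)) : Set (ℕ → T × Q) :=
  {ω | (fun i => (ω i).1) ∈ Ω}

/-- `Pr^{Γ^σ}_{(s,q_ι)}(Ω)`: the probability of the (lifted) objective `Ω` in the
Markov chain induced by `σ` started at `(s, σ.init)`. -/
noncomputable def MDP.Pr (M : MDP S Act) (σ : Strategy M) (s : S) (Ω : Set (ℕ → S)) : ℝ≥0∞ :=
  pathMeasure (M.step σ) (s, σ.init) (liftObj Ω)

/-- `Γ, σ, s ⊨ S(Ω)`: every path of the induced Markov chain from `(s, σ.init)`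
(surely) satisfies the lifted objective `Ω`. -/
def MDP.Sure (M : MDP S Act) (σ : Strategy M) (s : S) (Ω : Set (ℕ → S)) : Prop :=
  PathsFrom (M.step σ) (s, σ.init) ⊆ liftObj Ω

/-- The reachability objective `◇F`. -/
def ReachObj {T : Type*} (F : Set T) : Set (ℕ → T) := {π | ∃ k, π k ∈ F}

/-- The set of states occurring infinitely often on a path. -/
def InfOft {T : Type*} (π : ℕ → T) : Set T := {s | ∀ i, ∃ j, i ≤ j ∧ π j = s}

/-- The parity objective for the priority function `φ`: the maximal priority occurring
infinitely often is even. -/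
def ParityObj {T : Type*} (φ : T → ℕ) : Set (ℕ → T) := {π | Even (sSup (φ '' InfOft π))}

/-- A state is a sink if every enabled action loops with probability 1. -/
def MDP.IsSink (M : MDP S Act) (s : S) : Prop :=
  ∀ a, (∑ s', M.P s a s') = 1 → M.P s a s = 1

/-- `Γ` is clean w.r.t. the parity objective `φ`: from every state some strategy
surely satisfies `φ`. -/
def MDP.CleanParity (M : MDP S Act) (φ : S → ℕ) : Prop :=
  ∀ s, ∃ σ : Strategy M, M.Sure σ s (ParityObj φ)

/-- `Γ` is clean w.r.t. the target sets `F 1, …, F n`: every target state is a sink and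
from every state some strategy reaches `F = ⋃ i, F i` with probability 1. -/
def MDP.CleanTargets (M : MDP S Act) {n : ℕ} (F : Fin n → Set S) : Prop :=
  (∀ s ∈ ⋃ i, F i, M.IsSink s) ∧
  ∀ s, ∃ σ : Strategy M, 1 ≤ M.Pr σ s (ReachObj (⋃ i, F i))



namespace SwProof

/-! ### Limit maxima of sequences of naturals -/

def LimMax (c : ℕ → ℕ) (p : ℕ) : Prop :=
  (∃ᶠ i in Filter.atTop, c i = p) ∧ ∀ᶠ i in Filter.atTop, c i ≤ p

lemma LimMax.unique {c : ℕ → ℕ} {p q : ℕ} (hp : LimMax c p) (hq : LimMax c q) : p = q := by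
  obtain ⟨i, h1, h2⟩ := (hp.1.and_eventually hq.2).exists
  obtain ⟨j, h3, h4⟩ := (hq.1.and_eventually hp.2).exists
  omega

lemma LimMax.shift {c : ℕ → ℕ} {p : ℕ} (k : ℕ) :
    LimMax (fun i => c (i + k)) p ↔ LimMax c p := by
  unfold LimMax
  simp only [Filter.frequently_atTop, Filter.eventually_atTop]
  constructor
  · rintro ⟨h1, N, h2⟩
    refine ⟨fun a => ?_, N + k, fun b hb => ?_⟩
    · obtain ⟨b, hb, h⟩ := h1 a
      exact ⟨b + k, by omega, h⟩
    · have := h2 (b - k) (by omega)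
      rwa [Nat.sub_add_cancel (by omega)] at this
  · rintro ⟨h1, N, h2⟩
    refine ⟨fun a => ?_, N, fun b hb => h2 _ (by omega)⟩
    obtain ⟨b, hb, h⟩ := h1 (a + k)
    exact ⟨b - k, by omega, by rwa [Nat.sub_add_cancel (by omega)]⟩

lemma exists_limMax {V : Type*} [Finite V] (g : V → ℕ) (w : ℕ → V) :
    ∃ p, LimMax (fun i => g (w i)) p := by
  obtain ⟨B, hB⟩ : ∃ B, ∀ v, g v ≤ B := by
    obtain ⟨B, hB⟩ := (Set.finite_range g).bddAbove
    exact ⟨B, fun v => hB ⟨v, rfl⟩⟩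
  have hex : ∃ p, ∀ᶠ i in Filter.atTop, g (w i) ≤ p :=
    ⟨B, Filter.Eventually.of_forall fun i => hB _⟩
  refine ⟨Nat.find hex, ?_, Nat.find_spec hex⟩
  intro hne
  have h2 := Nat.find_spec hex
  rcases Nat.eq_zero_or_pos (Nat.find hex) with h0 | h0
  · obtain ⟨i, hi1, hi2⟩ := (hne.and h2).exists
    rw [h0] at hi1 hi2
    exact hi1 (Nat.le_zero.1 hi2)
  · refine Nat.find_min hex (m := Nat.find hex - 1) (by omega) ?_
    filter_upwards [hne, h2] with i hi1 hi2
    have : g (w i) ≠ Nat.find hex := hi1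
    omega

/-- relative version -/
def RelLim (T : ℕ → Prop) (c : ℕ → ℕ) (p : ℕ) : Prop :=
  (∃ᶠ i in Filter.atTop, T i ∧ c i = p) ∧ ∀ᶠ i in Filter.atTop, T i → c i ≤ p

lemma relLim_of_nth {T : ℕ → Prop} {c : ℕ → ℕ} {p : ℕ} (hT : {i | T i}.Infinite)
    (h : LimMax (fun j => c (Nat.nth T j)) p) : RelLim T c p := by
  have hm := Nat.nth_strictMono hT
  obtain ⟨h1, h2⟩ := h
  rw [Filter.frequently_atTop] at h1
  rw [Filter.eventually_atTop] at h2
  constructor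
  · rw [Filter.frequently_atTop]
    intro a
    obtain ⟨b, hb, h⟩ := h1 a
    exact ⟨Nat.nth T b, hb.trans (hm.id_le b), Nat.nth_mem_of_infinite hT b, h⟩
  · obtain ⟨N, hN⟩ := h2
    rw [Filter.eventually_atTop]
    refine ⟨Nat.nth T N, fun i hi hTi => ?_⟩
    obtain ⟨j, hj⟩ : i ∈ Set.range (Nat.nth T) := by
      rw [Nat.range_nth_of_infinite hT]; exact hTi
    subst hj
    exact hN j (hm.le_iff_le.1 hi)

lemma RelLim.combine {T : ℕ → Prop} {c : ℕ → ℕ}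
    (h1 : {i | T i}.Infinite → ∃ p, Odd p ∧ RelLim T c p)
    (h2 : {i | ¬ T i}.Infinite → ∃ p, Odd p ∧ RelLim (fun i => ¬ T i) c p) :
    ∃ p, Odd p ∧ LimMax c p := by
  by_cases i1 : {i | T i}.Infinite
  · obtain ⟨p, op, fp, ep⟩ := h1 i1
    by_cases i2 : {i | ¬ T i}.Infinite
    · obtain ⟨q, oq, fq, eq⟩ := h2 i2
      rcases le_total p q with h | h
      · refine ⟨q, oq, fq.mono fun i hi => hi.2, ?_⟩
        filter_upwards [ep, eq] with i a b
        by_cases hT : T i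
        · exact (a hT).trans h
        · exact b hT
      · refine ⟨p, op, fp.mono fun i hi => hi.2, ?_⟩
        filter_upwards [ep, eq] with i a b
        by_cases hT : T i
        · exact a hT
        · exact (b hT).trans h
    · refine ⟨p, op, fp.mono fun i hi => hi.2, ?_⟩
      have : ∀ᶠ i in Filter.atTop, ¬ ¬ T i := by
        rw [← Filter.not_frequently]
        rwa [Nat.frequently_atTop_iff_infinite]
      filter_upwards [ep, this] with i a b
      exact a (not_not.1 b)
  · have e1 : ∀ᶠ i in Filter.atTop, ¬ T i := by
      rw [← Filter.not_frequently]
      rwa [Nat.frequently_atTop_iff_infinite]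
    have i2 : {i | ¬ T i}.Infinite := by
      rw [← Nat.frequently_atTop_iff_infinite]
      exact e1.frequently
    obtain ⟨q, oq, fq, eq⟩ := h2 i2
    refine ⟨q, oq, fq.mono fun i hi => hi.2, ?_⟩
    filter_upwards [eq, e1] with i a b
    exact a b

/-! ### Half-positional determinacy of finite parity games -/

section Game

variable {V A : Type} (succ : V → A → Set V) (pr : V → ℕ)

def PosWin (En : Finset (V × A)) (u : V) : Prop :=
  ∃ f : V → A, (∀ v, (v, f v) ∈ En) ∧ ∀ w : ℕ → V, w 0 = u →
    (∀ i, w (i + 1) ∈ succ (w i) (f (w i))) → ∃ p, Even p ∧ LimMax (fun i => pr (w i)) p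

structure OppMach (En : Finset (V × A)) (u : V) where
  X : Type
  cur : X → V
  resp : X → A → X
  I : X → Prop
  x0 : X
  I0 : I x0
  cur0 : cur x0 = u
  legal : ∀ x a, I x → (cur x, a) ∈ En → I (resp x a) ∧ cur (resp x a) ∈ succ (cur x) a
  odd : ∀ (x : ℕ → X) (a : ℕ → A), I (x 0) →
    (∀ i, (cur (x i), a i) ∈ En ∧ x (i + 1) = resp (x i) (a i)) →
    ∃ p, Odd p ∧ LimMax (fun i => pr (cur (x i))) p

lemma run_proj {X : Type} (T : ℕ → Prop) (hT : {i | T i}.Infinite) (x : ℕ → X)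
    (hc : ∀ i, ¬ T i → x (i + 1) = x i) (j : ℕ) :
    x (Nat.nth T (j + 1)) = x (Nat.nth T j + 1) := by
  have hlt : Nat.nth T j < Nat.nth T (j + 1) := Nat.nth_strictMono hT (Nat.lt_succ_self j)
  have key : ∀ k, Nat.nth T j + 1 + k ≤ Nat.nth T (j + 1) →
      x (Nat.nth T j + 1 + k) = x (Nat.nth T j + 1) := by
    intro k
    induction k with
    | zero => intro _; rfl
    | succ k ih =>
      intro hk
      rw [← add_assoc, hc, ih (by omega)]
      intro hTk
      obtain ⟨l, hl⟩ : Nat.nth T j + 1 + k ∈ Set.range (Nat.nth T) := by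
        rw [Nat.range_nth_of_infinite hT]; exact hTk
      have hm : StrictMono (Nat.nth T) := Nat.nth_strictMono hT
      have h1 : j < l := hm.lt_iff_lt.1 (by omega)
      have h2 : l < j + 1 := hm.lt_iff_lt.1 (by omega)
      omega
  have := key (Nat.nth T (j + 1) - (Nat.nth T j + 1)) (by omega)
  rwa [Nat.add_sub_cancel' (by omega)] at this

variable {succ pr} in
noncomputable def interleave {En G1 G2 : Finset (V × A)} {u v : V} (a1 : A)
    (h1 : ∀ x a, (x, a) ∈ En → (x = v → a = a1) → (x, a) ∈ G1)
    (h2 : ∀ x a, (x, a) ∈ En → (x = v → a ≠ a1) → (x, a) ∈ G2)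
    (K : OppMach succ pr G1 u) (L : OppMach succ pr G2 v) : OppMach succ pr En u := by
  let cur : K.X × L.X × Bool → V := fun z => if z.2.2 then K.cur z.1 else L.cur z.2.1
  let side : K.X × L.X × Bool → A → Prop := fun z a =>
    if cur z = v then a = a1 else z.2.2 = true
  let resp : K.X × L.X × Bool → A → K.X × L.X × Bool := fun z a =>
    if side z a then (K.resp z.1 a, z.2.1, true) else (z.1, L.resp z.2.1 a, false)
  let I : K.X × L.X × Bool → Prop := fun z => K.I z.1 ∧ L.I z.2.1 ∧
    if z.2.2 then L.cur z.2.1 = v else K.cur z.1 = v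
  have s1 : ∀ z a, I z → side z a → (cur z, a) ∈ En →
      cur z = K.cur z.1 ∧ L.cur z.2.1 = v ∧ (cur z, a) ∈ G1 := by
    rintro ⟨x, y, b⟩ a hI hs he
    have hG : (cur (x, y, b), a) ∈ G1 := by
      refine h1 _ _ he fun hv => ?_
      simp only [side, hv, if_true] at hs
      exact hs
    cases b <;> simp_all [cur, side, I]
  have s2 : ∀ z a, I z → ¬ side z a → (cur z, a) ∈ En →
      cur z = L.cur z.2.1 ∧ K.cur z.1 = v ∧ (cur z, a) ∈ G2 := by
    rintro ⟨x, y, b⟩ a hI hs he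
    have hG : (cur (x, y, b), a) ∈ G2 := by
      refine h2 _ _ he fun hv => ?_
      simp only [side, hv, if_true] at hs
      exact hs
    cases b <;> simp_all [cur, side, I]
  have leg : ∀ x a, I x → (cur x, a) ∈ En → I (resp x a) ∧ cur (resp x a) ∈ succ (cur x) a := by
    intro z a hI he
    by_cases hs : side z a
    · obtain ⟨e1, e2, e3⟩ := s1 z a hI hs he
      rw [e1] at e3 ⊢
      obtain ⟨l1, l2⟩ := K.legal z.1 a hI.1 e3
      simp only [resp, hs, if_true]
      exact ⟨⟨l1, hI.2.1, by simpa using e2⟩, by simpa [cur] using l2⟩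
    · obtain ⟨e1, e2, e3⟩ := s2 z a hI hs he
      rw [e1] at e3 ⊢
      obtain ⟨l1, l2⟩ := L.legal z.2.1 a hI.2.1 e3
      simp only [resp, hs, if_false]
      exact ⟨⟨hI.1, l1, by simpa using e2⟩, by simpa [cur] using l2⟩
  refine ⟨K.X × L.X × Bool, cur, resp, I, (K.x0, L.x0, true),
    ⟨K.I0, L.I0, by simpa using L.cur0⟩, by simpa [cur] using K.cur0, leg, ?_⟩
  intro z a hI0 hrun
  have hI : ∀ i, I (z i) := by
    intro i
    induction i with
    | zero => exact hI0
    | succ i ih => rw [(hrun i).2]; exact (leg _ _ ih (hrun i).1).1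
  apply RelLim.combine (T := fun i => side (z i) (a i))
  · intro hT
    have hm := fun j => Nat.nth_mem_of_infinite hT j
    obtain ⟨p, op, hp⟩ := K.odd (fun j => (z (Nat.nth (fun i => side (z i) (a i)) j)).1)
      (fun j => a (Nat.nth (fun i => side (z i) (a i)) j)) (hI _).1 (by
        intro j
        obtain ⟨e1, e2, e3⟩ := s1 _ _ (hI _) (hm j) (hrun _).1
        refine ⟨by rw [← e1]; exact e3, ?_⟩
        rw [run_proj (fun i => side (z i) (a i)) hT (fun i => (z i).1), (hrun _).2]
        · simp only [resp]; rw [if_pos (hm j)]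
        · intro i hi
          simp only [(hrun i).2, resp]; rw [if_neg hi])
    refine ⟨p, op, relLim_of_nth hT ?_⟩
    convert hp using 3 with j
    exact (s1 _ _ (hI _) (hm j) (hrun _).1).1
  · intro hT
    have hm := fun j => Nat.nth_mem_of_infinite hT j
    obtain ⟨p, op, hp⟩ := L.odd (fun j => (z (Nat.nth (fun i => ¬ side (z i) (a i)) j)).2.1)
      (fun j => a (Nat.nth (fun i => ¬ side (z i) (a i)) j)) (hI _).2.1 (by
        intro j
        obtain ⟨e1, e2, e3⟩ := s2 _ _ (hI _) (hm j) (hrun _).1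
        refine ⟨by rw [← e1]; exact e3, ?_⟩
        rw [run_proj (fun i => ¬ side (z i) (a i)) hT (fun i => (z i).2.1), (hrun _).2]
        · simp only [resp]; rw [if_neg (hm j)]
        · intro i hi
          simp only [(hrun i).2, resp]; rw [if_pos (not_not.1 hi)])
    refine ⟨p, op, relLim_of_nth hT ?_⟩
    convert hp using 3 with j
    exact (s2 _ _ (hI _) (hm j) (hrun _).1).1

theorem game_det [Finite V] (n : ℕ) : ∀ (En : Finset (V × A)), En.card = n →
    (∀ v, ∃ a, (v, a) ∈ En) → ∀ u, PosWin succ pr En u ∨ Nonempty (OppMach succ pr En u) := by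
  induction n using Nat.strong_induction_on with
  | _ n IH =>
  intro En hcard hne u
  by_cases hsplit : ∃ v a1 a2, (v, a1) ∈ En ∧ (v, a2) ∈ En ∧ a1 ≠ a2
  · obtain ⟨v, a1, a2, m1, m2, hne12⟩ := hsplit
    set G1 := En.filter (fun z => z.1 = v → z.2 = a1) with hG1
    set G2 := En.filter (fun z => z.1 = v → z.2 ≠ a1) with hG2
    have c1 : G1.card < n := by
      rw [← hcard]
      refine Finset.card_lt_card (Finset.filter_ssubset.2 ⟨(v, a2), m2, ?_⟩)
      simp [hne12.symm]
    have c2 : G2.card < n := by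
      rw [← hcard]
      refine Finset.card_lt_card (Finset.filter_ssubset.2 ⟨(v, a1), m1, ?_⟩)
      simp
    have n1 : ∀ x, ∃ a, (x, a) ∈ G1 := by
      intro x
      by_cases hx : x = v
      · exact ⟨a1, by subst hx; simp [hG1, m1]⟩
      · obtain ⟨a, ha⟩ := hne x
        exact ⟨a, by simp [hG1, ha, hx]⟩
    have n2 : ∀ x, ∃ a, (x, a) ∈ G2 := by
      intro x
      by_cases hx : x = v
      · exact ⟨a2, by subst hx; simp [hG2, m2, hne12.symm]⟩
      · obtain ⟨a, ha⟩ := hne x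
        exact ⟨a, by simp [hG2, ha, hx]⟩
    have mono : ∀ G ⊆ En, PosWin succ pr G u → PosWin succ pr En u := by
      rintro G hG ⟨f, hf, h⟩
      exact ⟨f, fun v => hG (hf v), h⟩
    rcases IH _ c1 G1 rfl n1 u with h | ⟨⟨K⟩⟩
    · exact Or.inl (mono _ (Finset.filter_subset _ _) h)
    rcases IH _ c2 G2 rfl n2 u with h | ⟨⟨L⟩⟩
    · exact Or.inl (mono _ (Finset.filter_subset _ _) h)
    rcases IH _ c2 G2 rfl n2 v with ⟨f, hf, hw⟩ | ⟨⟨N⟩⟩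
    · right
      have avoid : ∀ x, L.I x → L.cur x ≠ v := by
        intro x hx hv
        let r : ℕ → L.X := fun i => Nat.rec x (fun _ y => L.resp y (f (L.cur y))) i
        have hr : ∀ i, r (i + 1) = L.resp (r i) (f (L.cur (r i))) := fun i => rfl
        have hI : ∀ i, L.I (r i) := by
          intro i
          induction i with
          | zero => exact hx
          | succ i ih => rw [hr]; exact (L.legal _ _ ih (hf _)).1
        obtain ⟨p, op, hp⟩ := L.odd r (fun i => f (L.cur (r i))) hx fun i => ⟨hf _, hr i⟩
        obtain ⟨q, oq, hq⟩ := hw (fun i => L.cur (r i)) hv fun i => by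
          rw [hr]; exact (L.legal _ _ (hI i) (hf _)).2
        rw [hp.unique hq] at op
        exact (Nat.not_even_iff_odd.2 op) oq
      have mem : ∀ x a, L.I x → (L.cur x, a) ∈ En → (L.cur x, a) ∈ G2 := by
        intro x a hx he
        simp [hG2, he, avoid x hx]
      refine ⟨⟨L.X, L.cur, L.resp, L.I, L.x0, L.I0, L.cur0,
        fun x a hx he => L.legal x a hx (mem x a hx he), ?_⟩⟩
      intro x a h0 hrun
      have hI : ∀ i, L.I (x i) := by
        intro i
        induction i with
        | zero => exact h0
        | succ i ih => rw [(hrun i).2]; exact (L.legal _ _ ih (mem _ _ ih (hrun i).1)).1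
      exact L.odd x a h0 fun i => ⟨mem _ _ (hI i) (hrun i).1, (hrun i).2⟩
    · right
      exact ⟨interleave a1 (fun x a he h => by simp [hG1, he]; exact h)
        (fun x a he h => by simp [hG2, he]; exact h) K N⟩
  · push Not at hsplit
    choose f hf using hne
    by_cases hP : PosWin succ pr En u
    · exact Or.inl hP
    right
    have : ∃ w : ℕ → V, w 0 = u ∧ (∀ i, w (i + 1) ∈ succ (w i) (f (w i))) ∧
        ¬ ∃ p, Even p ∧ LimMax (fun i => pr (w i)) p := by
      by_contra hcon
      push Not at hcon
      exact hP ⟨f, hf, fun w h0 hs => by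
        obtain ⟨p, hp⟩ := hcon w h0 hs
        exact ⟨p, hp⟩⟩
    obtain ⟨w, h0, hs, hbad⟩ := this
    refine ⟨⟨ℕ, w, fun n _ => n + 1, fun _ => True, 0, trivial, h0, ?_, ?_⟩⟩
    · intro x a _ he
      refine ⟨trivial, ?_⟩
      rw [hsplit _ _ _ he (hf _)]
      exact hs x
    · intro x a _ hrun
      have hx : ∀ i, x i = i + x 0 := by
        intro i
        induction i with
        | zero => simp
        | succ i ih => rw [(hrun i).2, ih]; ring
      obtain ⟨p, hp⟩ := exists_limMax pr w
      refine ⟨p, ?_, ?_⟩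
      · rw [← Nat.not_even_iff_odd]
        exact fun he => hbad ⟨p, he, hp⟩
      · rw [← LimMax.shift (x 0)] at hp
        convert hp using 3 with i
        rw [hx]

end Game

/-! ### Path measures -/

section PathMeasure

variable {T : Type} [Countable T]

theorem exists_pathMeasure (P : T → T → ℝ≥0∞) (hP : ∀ x, ∑' y, P x y = 1) (s : T) :
    ∃ μ, IsPathMeasure P s μ := by
  let : MeasurableSpace T := ⊤
  have : DiscreteMeasurableSpace T := ⟨fun _ => trivial⟩
  obtain ⟨pm, hpm⟩ : ∃ pm : T → PMF T, ∀ x y, pm x y = P x y :=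
    ⟨fun x => ⟨P x, by rw [← hP x]; exact ENNReal.summable.hasSum⟩, fun _ _ => rfl⟩
  let ν : T → Measure T := fun x => (pm x).toMeasure
  have hν : ∀ x y, ν x {y} = P x y := fun x y => by
    simp only [ν]
    rw [PMF.toMeasure_apply_singleton _ _ (measurableSet_singleton y), hpm]
  have hν1 : ∀ x, IsProbabilityMeasure (ν x) := fun x => by
    simp only [ν]; infer_instance
  let κ : (n : ℕ) → ProbabilityTheory.Kernel ((i : Finset.Iic n) → T) T := fun n =>
    ⟨fun w => ν (w ⟨n, by simp⟩), by
      exact (measurable_of_countable ν).comp (measurable_pi_apply _)⟩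
  have : ∀ n, ProbabilityTheory.IsMarkovKernel (κ n) := fun n => ⟨fun w => hν1 _⟩
  let μ := ProbabilityTheory.Kernel.trajMeasure (X := fun _ => T) (Measure.dirac s) κ
  have hcyl : ∀ (π : ℕ → T) k, Cyl π k = (Preorder.frestrictLe (π := fun _ => T) k) ⁻¹' {Preorder.frestrictLe k π} := by
    intro π k
    ext ω
    simp only [Cyl, Set.mem_ofPred_eq, Set.mem_preimage, Set.mem_singleton_iff, funext_iff]
    exact ⟨fun h i => h i (Finset.mem_Iic.1 i.2), fun h i hi => h ⟨i, Finset.mem_Iic.2 hi⟩⟩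
  have hsucc : ∀ (π : ℕ → T) k, μ (Cyl π (k + 1)) = μ (Cyl π k) * P (π k) (π (k + 1)) := by
    intro π k
    have h := ProbabilityTheory.Kernel.map_frestrictLe_trajMeasure_compProd_eq_map_trajMeasure
      (X := fun _ => T) (μ₀ := Measure.dirac s) (κ := κ) (a := k)
    have h2 := congrArg (fun m => m ({Preorder.frestrictLe k π} ×ˢ {π (k + 1)})) h
    rw [Measure.compProd_apply_prod (measurableSet_singleton _) (measurableSet_singleton _),
      Measure.map_apply (by fun_prop) ((measurableSet_singleton _).prod (measurableSet_singleton _)),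
      Measure.restrict_singleton, lintegral_smul_measure, lintegral_dirac,
      Measure.map_apply (by fun_prop) (measurableSet_singleton _), ← hcyl] at h2
    have e1 : Cyl π (k + 1) = (fun x : ℕ → T => (Preorder.frestrictLe (π := fun _ => T) k x, x (k + 1))) ⁻¹'
        ({Preorder.frestrictLe k π} ×ˢ {π (k + 1)}) := by
      ext ω
      have : ω ∈ Cyl π (k + 1) ↔ ω ∈ Cyl π k ∧ ω (k + 1) = π (k + 1) := ?_
      · rw [this, hcyl]; rfl
      constructor
      · intro h; exact ⟨fun i hi => h i (by omega), h _ le_rfl⟩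
      · rintro ⟨h, h'⟩ i hi
        rcases Nat.lt_or_ge k i with hk | hk
        · obtain rfl : i = k + 1 := by omega
          exact h'
        · exact h i hk
    rw [e1]
    refine h2.symm.trans ?_
    rw [smul_eq_mul]
    congr 1
    exact hν _ _
  have h0 : ∀ π : ℕ → T, μ (Cyl π 0) = if π 0 = s then 1 else 0 := by
    intro π
    rw [hcyl, ← Measure.map_apply (by fun_prop) (measurableSet_singleton _)]
    simp only [μ, ProbabilityTheory.Kernel.trajMeasure]
    rw [Measure.map_comp _ _ (by fun_prop), ProbabilityTheory.Kernel.traj_map_frestrictLe,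
      ProbabilityTheory.Kernel.partialTraj_self, Measure.id_comp, Measure.map_dirac' (by fun_prop),
      Measure.dirac_apply' _ (measurableSet_singleton _)]
    simp only [Set.indicator, Set.mem_singleton_iff, Pi.one_apply]
    congr 1
    rw [eq_iff_iff, funext_iff]
    constructor
    · intro h
      exact (h ⟨0, by simp⟩).symm
    · rintro h ⟨i, hi⟩
      obtain rfl : i = 0 := by simpa using hi
      exact h.symm
  refine ⟨μ, measure_univ (μ := μ), fun π k => ?_⟩
  induction k with
  | zero => rw [Finset.range_zero, Finset.prod_empty]; exact h0 π
  | succ k ih =>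
    rw [Finset.prod_range_succ]
    refine (hsucc π k).trans ?_
    rw [show μ (Cyl π k) = _ from ih]
    split_ifs <;> simp

noncomputable def reachN (P : T → T → ℝ≥0∞) (F : Set T) : ℕ → T → ℝ≥0∞
  | 0, x => if x ∈ F then 1 else 0
  | n + 1, x => if x ∈ F then 1 else ∑' y, P x y * reachN P F n y

theorem pathMeasure_reach (P : T → T → ℝ≥0∞) (hP : ∀ x, ∑' y, P x y = 1) (s : T) (F : Set T) :
    pathMeasure P s {ω | ∃ k, ω k ∈ F} = ⨆ n, reachN P F n s := by
  have hex := exists_pathMeasure P hP s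
  have hpm : IsPathMeasure P s (pathMeasure P s) := by
    unfold pathMeasure; rw [dif_pos hex]; exact hex.choose_spec
  generalize pathMeasure P s = μ at hpm
  let : MeasurableSpace T := ⊤
  have : DiscreteMeasurableSpace T := ⟨fun _ => trivial⟩
  change @Measure (ℕ → T) MeasurableSpace.pi at μ
  obtain ⟨hu, hc⟩ := hpm
  have mcoord : ∀ (k : ℕ) (A : Set T), MeasurableSet {ω : ℕ → T | ω k ∈ A} := fun k A =>
    measurable_pi_apply k (MeasurableSet.of_discrete (s := A))
  have mcyl : ∀ (π : ℕ → T) k, MeasurableSet (Cyl π k) := fun π k => by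
    have : Cyl π k = ⋂ i, ⋂ (_ : i ≤ k), {ω : ℕ → T | ω i ∈ ({π i} : Set T)} := by
      ext ω; simp [Cyl]
    rw [this]
    exact MeasurableSet.iInter fun i => MeasurableSet.iInter fun _ => mcoord _ _
  have mre : ∀ k n, MeasurableSet {ω : ℕ → T | ∃ j ≤ n, ω (k + j) ∈ F} := fun k n => by
    have : {ω : ℕ → T | ∃ j ≤ n, ω (k + j) ∈ F} = ⋃ j, ⋃ (_ : j ≤ n), {ω : ℕ → T | ω (k + j) ∈ F} := by
      ext ω; simp
    rw [this]
    exact MeasurableSet.iUnion fun i => MeasurableSet.iUnion fun _ => mcoord _ _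
  have hsucc : ∀ (π : ℕ → T) k, μ (Cyl π (k + 1)) = μ (Cyl π k) * P (π k) (π (k + 1)) := by
    intro π k
    have e1 := hc π (k + 1)
    have e2 := hc π k
    rw [Finset.prod_range_succ] at e1
    refine Eq.trans e1 ?_
    refine Eq.trans ?_ (congrArg (· * _) e2.symm)
    split_ifs <;> simp
  have key : ∀ n (π : ℕ → T) k, μ (Cyl π k ∩ {ω | ∃ j ≤ n, ω (k + j) ∈ F}) =
      μ (Cyl π k) * reachN P F n (π k) := by
    intro n
    induction n with
    | zero =>
      intro π k
      by_cases h : π k ∈ F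
      · have : Cyl π k ∩ {ω | ∃ j ≤ 0, ω (k + j) ∈ F} = Cyl π k := by
          apply Set.inter_eq_left.2
          intro ω hω
          exact ⟨0, le_rfl, by rw [add_zero, hω k le_rfl]; exact h⟩
        rw [this]; simp [reachN, h]
      · have : Cyl π k ∩ {ω | ∃ j ≤ 0, ω (k + j) ∈ F} = ∅ := by
          ext ω
          simp only [Set.mem_inter_iff, Set.mem_ofPred_eq, Set.mem_empty_iff_false, iff_false]
          rintro ⟨hω, j, hj, hF⟩
          obtain rfl : j = 0 := by omega
          rw [add_zero, hω k le_rfl] at hF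
          exact h hF
        rw [this]; simp [reachN, h]
    | succ n ih =>
      intro π k
      by_cases h : π k ∈ F
      · have : Cyl π k ∩ {ω | ∃ j ≤ n + 1, ω (k + j) ∈ F} = Cyl π k := by
          apply Set.inter_eq_left.2
          intro ω hω
          exact ⟨0, by omega, by rw [add_zero, hω k le_rfl]; exact h⟩
        rw [this]; simp [reachN, h]
      · have hset : Cyl π k ∩ {ω | ∃ j ≤ n + 1, ω (k + j) ∈ F} =
            ⋃ y, Cyl (Function.update π (k + 1) y) (k + 1) ∩ {ω | ∃ j ≤ n, ω (k + 1 + j) ∈ F} := by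
          ext ω
          simp only [Set.mem_inter_iff, Set.mem_ofPred_eq, Set.mem_iUnion]
          constructor
          · rintro ⟨hω, j, hj, hF⟩
            refine ⟨ω (k + 1), ?_, ?_⟩
            · intro i hi
              rcases Nat.lt_or_ge k i with hk | hk
              · obtain rfl : i = k + 1 := by omega
                simp
              · rw [Function.update_of_ne (by omega)]; exact hω i hk
            · cases j with
              | zero => rw [add_zero, hω k le_rfl] at hF; exact absurd hF h
              | succ j => exact ⟨j, by omega, by rwa [add_right_comm, add_assoc]⟩
          · rintro ⟨y, hω, j, hj, hF⟩
            refine ⟨?_, j + 1, by omega, by rwa [add_right_comm, add_assoc] at hF⟩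
            intro i hi
            rw [hω i (by omega), Function.update_of_ne (by omega)]
        rw [hset, measure_iUnion]
        · simp only [reachN, h, if_false]
          rw [← ENNReal.tsum_mul_left]
          congr 1
          ext y
          rw [ih, hsucc]
          have : Cyl (Function.update π (k + 1) y) k = Cyl π k := by
            ext ω
            simp only [Cyl, Set.mem_ofPred_eq]
            refine forall_congr' fun i => forall_congr' fun hi => ?_
            rw [Function.update_of_ne (by omega)]
          rw [this]
          simp [mul_assoc]
        · intro y z hyz
          rw [Function.onFun, Set.disjoint_left]
          rintro ω ⟨h1, -⟩ ⟨h2, -⟩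
          have a1 := h1 (k + 1) le_rfl
          have a2 := h2 (k + 1) le_rfl
          simp at a1 a2
          exact hyz (a1.symm.trans a2)
        · intro y
          exact (mcyl _ _).inter (mre _ _)
  have hs : μ (Cyl (fun _ => s) 0) = 1 := by
    refine (hc _ 0).trans ?_
    simp
  have hs' : ∀ᵐ ω ∂μ, ω ∈ Cyl (fun _ => s) 0 := by
    have : IsProbabilityMeasure μ := ⟨hu⟩
    rw [← prob_compl_eq_zero_iff (mcyl _ _)] at hs
    exact hs
  have hmeas : ∀ n, μ {ω | ∃ j ≤ n, ω j ∈ F} = reachN P F n s := by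
    intro n
    have := key n (fun _ => s) 0
    rw [hs, one_mul] at this
    rw [← this]
    refine measure_congr ?_
    filter_upwards [hs'] with ω hω
    refine propext ?_
    change _ ↔ _ ∧ _
    simp only [zero_add]
    exact ⟨fun h => ⟨hω, h⟩, fun h => h.2⟩
  have hU : {ω : ℕ → T | ∃ k, ω k ∈ F} = ⋃ n, {ω | ∃ j ≤ n, ω j ∈ F} := by
    ext ω
    simp only [Set.mem_ofPred_eq, Set.mem_iUnion]
    exact ⟨fun ⟨k, hk⟩ => ⟨k, k, le_rfl, hk⟩, fun ⟨n, k, _, hk⟩ => ⟨k, hk⟩⟩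
  refine Eq.trans (congrArg μ hU) ?_
  refine Eq.trans (Monotone.measure_iUnion (μ := μ) ?_) ?_
  · intro a b hab ω ⟨j, hj, h⟩
    exact ⟨j, hj.trans hab, h⟩
  · exact iSup_congr hmeas

end PathMeasure

/-! ### Values in induced Markov chains -/

lemma ennsum_eq {ι : Type*} [Fintype ι] (a b : ι → ℝ≥0∞) (h : ∀ i, a i ≤ b i)
    (hs : ∑ i, a i = ∑ i, b i) (hf : ∑ i, b i ≠ ⊤) (j : ι) : a j = b j := by
  refine le_antisymm (h j) ?_
  rw [← Finset.add_sum_erase _ a (Finset.mem_univ j),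
    ← Finset.add_sum_erase _ b (Finset.mem_univ j)] at hs
  have hR : ∑ i ∈ Finset.univ.erase j, b i ≠ ⊤ := by
    refine ne_top_of_le_ne_top hf ?_
    exact Finset.sum_le_sum_of_subset (Finset.erase_subset _ _)
  have hle : ∑ i ∈ Finset.univ.erase j, a i ≤ ∑ i ∈ Finset.univ.erase j, b i :=
    Finset.sum_le_sum fun i _ => h i
  refine (ENNReal.add_le_add_iff_right hR).1 ?_
  rw [← hs]
  gcongr

lemma wavg_eq {ι : Type*} [Fintype ι] (w g : ι → ℝ≥0∞) (c : ℝ≥0∞) (hc : c ≠ ⊤)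
    (hw : ∑ i, w i = 1) (hg : (∀ i, w i ≠ 0 → g i ≤ c) ∨ (∀ i, w i ≠ 0 → c ≤ g i))
    (hs : ∑ i, w i * g i = c) (j : ι) (hj : w j ≠ 0) : g j = c := by
  have hwj : w j ≠ ⊤ := by
    refine ne_top_of_le_ne_top ENNReal.one_ne_top ?_
    rw [← hw]
    exact Finset.single_le_sum (fun _ _ => zero_le) (Finset.mem_univ j)
  have h1 : ∑ i, w i * c = c := by rw [← Finset.sum_mul, hw, one_mul]
  have key : w j * g j = w j * c := by
    rcases hg with hg | hg
    · refine ennsum_eq (fun i => w i * g i) (fun i => w i * c) (fun i => ?_)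
        (by rw [hs, h1]) (by rwa [h1]) j
      by_cases h : w i = 0
      · simp [h]
      · have := hg i h
        gcongr
    · refine (ennsum_eq (fun i => w i * c) (fun i => w i * g i) (fun i => ?_)
        (by rw [hs, h1]) (by rwa [hs]) j).symm
      by_cases h : w i = 0
      · simp [h]
      · have := hg i h
        gcongr
  exact (ENNReal.mul_right_inj hj hwj).1 key

section Val

variable (M : MDP S Act) (σ : Strategy M)

noncomputable def W (s : S) (q : σ.Q) (s' : S) : ℝ≥0∞ := ∑ a, σ.out q s a * M.P s a s'

lemma W_ne_zero {s : S} {q : σ.Q} {s' : S} :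
    W M σ s q s' ≠ 0 ↔ ∃ a, σ.out q s a ≠ 0 ∧ M.P s a s' ≠ 0 := by
  simp [W, Finset.sum_eq_zero_iff]

lemma W_sum (s : S) (q : σ.Q) : ∑ s', W M σ s q s' = 1 := by
  unfold W
  rw [Finset.sum_comm, ← σ.out_sum q s]
  refine Finset.sum_congr rfl fun a _ => ?_
  rw [← Finset.mul_sum]
  by_cases h : σ.out q s a = 0
  · simp [h]
  · rw [σ.out_enabled q s a h, mul_one]

lemma step_tsum (x : S × σ.Q) (g : S × σ.Q → ℝ≥0∞) :
    ∑' y, M.step σ x y * g y = ∑ s', W M σ x.1 x.2 s' * g (s', σ.next x.2 x.1) := by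
  rw [ENNReal.tsum_prod', tsum_fintype]
  refine Finset.sum_congr rfl fun s' _ => ?_
  rw [tsum_eq_single (σ.next x.2 x.1)]
  · simp [MDP.step, W]
  · intro q hq
    simp [MDP.step, hq.symm]

noncomputable def rN (F : Set S) : ℕ → S → σ.Q → ℝ≥0∞
  | 0, s, _ => if s ∈ F then 1 else 0
  | n + 1, s, q => if s ∈ F then 1 else ∑ s', W M σ s q s' * rN F n s' (σ.next q s)

noncomputable def val (F : Set S) (s : S) (q : σ.Q) : ℝ≥0∞ := ⨆ n, rN M σ F n s q

lemma reachN_eq (F : Set S) (n : ℕ) : ∀ x : S × σ.Q,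
    reachN (M.step σ) {x | x.1 ∈ F} n x = rN M σ F n x.1 x.2 := by
  induction n with
  | zero => intro x; rfl
  | succ n ih =>
    intro x
    simp only [reachN, rN, step_tsum, ih]
    rfl

lemma Pr_eq (F : Set S) (s : S) : M.Pr σ s (ReachObj F) = val M σ F s σ.init := by
  have := σ.countable
  have h := pathMeasure_reach (M.step σ) (fun x => by
    have := step_tsum M σ x (fun _ => 1)
    simpa [W_sum] using this) (s, σ.init) {x | x.1 ∈ F}
  simp only [reachN_eq] at h
  exact h

variable {M σ} {F : Set S}

lemma rN_F {n : ℕ} {s : S} {q : σ.Q} (h : s ∈ F) : rN M σ F n s q = 1 := by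
  cases n <;> simp [rN, h]

lemma rN_le_one (n : ℕ) : ∀ (s : S) (q : σ.Q), rN M σ F n s q ≤ 1 := by
  induction n with
  | zero => intro s q; simp only [rN]; split_ifs <;> simp
  | succ n ih =>
    intro s q
    simp only [rN]
    split_ifs
    · exact le_rfl
    · rw [← W_sum M σ s q]
      refine Finset.sum_le_sum fun s' _ => ?_
      exact mul_le_of_le_one_right' (ih _ _)

lemma rN_succ_le (n : ℕ) : ∀ (s : S) (q : σ.Q), rN M σ F n s q ≤ rN M σ F (n + 1) s q := by
  induction n with
  | zero => intro s q; simp only [rN]; split_ifs <;> simp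
  | succ n ih =>
    intro s q
    rw [rN, rN]
    split_ifs
    · exact le_rfl
    · refine Finset.sum_le_sum fun s' _ => ?_
      gcongr
      exact ih _ _

lemma rN_mono (s : S) (q : σ.Q) : Monotone fun n => rN M σ F n s q :=
  monotone_nat_of_le_succ fun n => rN_succ_le n s q

lemma val_le_one (s : S) (q : σ.Q) : val M σ F s q ≤ 1 := iSup_le fun n => rN_le_one n s q

lemma val_F {s : S} {q : σ.Q} (h : s ∈ F) : val M σ F s q = 1 := by
  simp [val, rN_F h]

lemma val_step {s : S} {q : σ.Q} (h : s ∉ F) :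
    val M σ F s q = ∑ s', W M σ s q s' * val M σ F s' (σ.next q s) := by
  have h1 : val M σ F s q = ⨆ n, rN M σ F (n + 1) s q :=
    ((rN_mono (M := M) (F := F) s q).iSup_nat_add 1).symm
  rw [h1]
  simp only [rN, h, if_false, val, ENNReal.mul_iSup]
  rw [ENNReal.finsetSum_iSup_of_monotone]
  intro s' a b hab
  exact mul_le_mul_right (rN_mono _ _ hab) _

lemma sink_stay (hsink : ∀ t ∈ F, M.IsSink t) {s s' : S} {q : σ.Q} (hs : s ∈ F)
    (hw : W M σ s q s' ≠ 0) : s' = s := by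
  obtain ⟨a, h1, h2⟩ := (W_ne_zero M σ).1 hw
  have h3 := σ.out_enabled q s a h1
  have h4 := hsink s hs a h3
  by_contra hne
  have h5 : ∑ x ∈ ({s, s'} : Finset S), M.P s a x ≤ 1 := by
    rw [← h3]
    exact Finset.sum_le_sum_of_subset (Finset.subset_univ _)
  rw [Finset.sum_pair (Ne.symm hne), h4] at h5
  have h6 : (1 : ℝ≥0∞) < 1 + M.P s a s' := ENNReal.lt_add_right ENNReal.one_ne_top h2
  exact absurd h5 (not_le.2 h6)

lemma val_one_step (hsink : ∀ t ∈ F, M.IsSink t) {s s' : S} {q : σ.Q} (hv : val M σ F s q = 1)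
    (hw : W M σ s q s' ≠ 0) : val M σ F s' (σ.next q s) = 1 := by
  by_cases hs : s ∈ F
  · exact val_F (by rw [sink_stay hsink hs hw]; exact hs)
  · rw [val_step hs] at hv
    exact wavg_eq _ (fun s' => val M σ F s' (σ.next q s)) 1 ENNReal.one_ne_top (W_sum M σ s q)
      (Or.inl fun i _ => val_le_one _ _) hv s' hw

lemma val_path {s : S} {q : σ.Q} (hs : s ∉ F) {n : ℕ} (h : rN M σ F n s q ≠ 0) :
    ∃ m < n, ∃ s', W M σ s q s' ≠ 0 ∧ rN M σ F m s' (σ.next q s) ≠ 0 := by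
  cases n with
  | zero => simp [rN, hs] at h
  | succ n =>
    simp only [rN, hs, if_false] at h
    obtain ⟨s', -, h'⟩ := Finset.exists_ne_zero_of_sum_ne_zero h
    exact ⟨n, by omega, s', left_ne_zero_of_mul h', right_ne_zero_of_mul h'⟩

lemma parity_eq (φ : S → ℕ) (π : ℕ → S) {p : ℕ} (h : LimMax (fun i => φ (π i)) p) :
    sSup (φ '' InfOft π) = p := by
  refine IsGreatest.csSup_eq ⟨?_, ?_⟩
  · by_contra hcon
    have h1 : ∀ t : S, ∀ᶠ i in Filter.atTop, π i = t → φ t ≠ p := by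
      intro t
      by_cases ht : φ t = p
      · have : t ∉ InfOft π := fun h => hcon ⟨t, h, ht⟩
        simp only [InfOft, Set.mem_ofPred_eq] at this
        push Not at this
        obtain ⟨i, hi⟩ := this
        filter_upwards [Filter.eventually_ge_atTop i] with j hj h
        exact absurd h (hi j hj)
      · exact Filter.Eventually.of_forall fun i _ => ht
    rw [← Filter.eventually_all] at h1
    obtain ⟨i, hi1, hi2⟩ := (h.1.and_eventually h1).exists
    exact hi2 (π i) rfl hi1
  · rintro _ ⟨t, ht, rfl⟩
    obtain ⟨N, hN⟩ := Filter.eventually_atTop.1 h.2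
    obtain ⟨j, hj, rfl⟩ := ht N
    exact hN j hj

lemma parity_iff (φ : S → ℕ) (π : ℕ → S) :
    π ∈ ParityObj φ ↔ ∃ p, Even p ∧ LimMax (fun i => φ (π i)) p := by
  obtain ⟨p, hp⟩ := exists_limMax φ π
  change Even _ ↔ _
  rw [parity_eq φ π hp]
  constructor
  · intro h; exact ⟨p, h, hp⟩
  · rintro ⟨q, hq, h⟩; rwa [hp.unique h]

end Val

/-! ### Combining a parity condition with a Buchi condition -/

lemma track_inf {c m : ℕ → ℕ} {b : ℕ → Bool}
    (hm : ∀ i, m (i + 1) = if b i = true then c (i + 1) else max (m i) (c (i + 1)))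
    (hb : ∃ᶠ i in Filter.atTop, b i = true) {p : ℕ} (hp : LimMax c p) :
    LimMax (fun i => if b i = true then m i + 2 else 1) (p + 2) := by
  obtain ⟨h1, h2⟩ := hp
  rw [Filter.frequently_atTop] at h1 hb
  obtain ⟨N, hN⟩ := Filter.eventually_atTop.1 h2
  obtain ⟨i0, hi0, hbi0⟩ := hb N
  have hle : ∀ k, m (i0 + 1 + k) ≤ p := by
    intro k
    induction k with
    | zero => rw [add_zero, hm, if_pos hbi0]; exact hN _ (by omega)
    | succ k ih =>
      rw [← add_assoc, hm]
      have := hN (i0 + 1 + k + 1) (by omega)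
      split_ifs
      · exact this
      · exact max_le ih this
  have hge : ∀ j, c j ≤ m j ∨ j = 0 := by
    intro j
    cases j with
    | zero => right; rfl
    | succ j =>
      left; rw [hm]; split_ifs
      · exact le_rfl
      · exact le_max_right _ _
  constructor
  · rw [Filter.frequently_atTop]
    intro K
    obtain ⟨j, hj, hcj⟩ := h1 (K + i0 + 1)
    have hex : ∃ l, b (j + l) = true := by
      obtain ⟨l, hl, h⟩ := hb j
      exact ⟨l - j, by rwa [Nat.add_sub_cancel' hl]⟩
    have hmono : ∀ l, l ≤ Nat.find hex → p ≤ m (j + l) := by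
      intro l
      induction l with
      | zero =>
        intro _
        rcases hge j with h | h
        · rw [← hcj]; exact h
        · omega
      | succ l ih =>
        intro hl
        have hnb : ¬ b (j + l) = true := Nat.find_min hex (by omega)
        rw [← add_assoc, hm, if_neg hnb]
        exact (ih (by omega)).trans (le_max_left _ _)
    refine ⟨j + Nat.find hex, by omega, ?_⟩
    have h3 := hmono _ le_rfl
    have h4 := hle (j + Nat.find hex - (i0 + 1))
    rw [Nat.add_sub_cancel' (by omega)] at h4
    simp only [Nat.find_spec hex, if_true]
    omega
  · rw [Filter.eventually_atTop]
    refine ⟨i0 + 1, fun i hi => ?_⟩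
    have h4 := hle (i - (i0 + 1))
    rw [Nat.add_sub_cancel' hi] at h4
    change (if b i = true then m i + 2 else 1) ≤ p + 2
    split_ifs <;> omega

lemma track_fin {m : ℕ → ℕ} {b : ℕ → Bool} (hb : ¬ ∃ᶠ i in Filter.atTop, b i = true) :
    LimMax (fun i => if b i = true then m i + 2 else 1) 1 := by
  rw [Filter.not_frequently] at hb
  constructor
  · refine Filter.Eventually.frequently ?_
    filter_upwards [hb] with i hi
    simp [hi]
  · filter_upwards [hb] with i hi
    simp [hi]

section MGame

variable (M : MDP S Act) (φ : S → ℕ) (F : Set S)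

noncomputable def upd (v : S × S × Bool) (d s' : S) : S × S × Bool :=
  (s', if v.2.2 = true ∨ φ v.2.1 ≤ φ s' then s' else v.2.1, decide (s' ≠ d ∨ s' ∈ F))

def gsucc (v : S × S × Bool) (a : Act × S) : Set (S × S × Bool) :=
  {v' | M.P v.1 a.1 v'.1 ≠ 0 ∧ v' = upd φ F v a.2 v'.1}

def gpr (v : S × S × Bool) : ℕ := if v.2.2 = true then φ v.2.1 + 2 else 1

noncomputable def gEn : Finset ((S × S × Bool) × (Act × S)) :=
  Finset.univ.filter fun z => (∑ s', M.P z.1.1 z.2.1 s') = 1 ∧ M.P z.1.1 z.2.1 z.2.2 ≠ 0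

lemma mem_gEn {v : S × S × Bool} {a : Act × S} :
    (v, a) ∈ gEn M ↔ (∑ s', M.P v.1 a.1 s') = 1 ∧ M.P v.1 a.1 a.2 ≠ 0 := by
  simp [gEn]

lemma gEn_ne (v : S × S × Bool) : ∃ a, (v, a) ∈ gEn M := by
  obtain ⟨a, ha⟩ := M.exists_enabled v.1
  have : ∑ s', M.P v.1 a s' ≠ 0 := by rw [ha]; exact one_ne_zero
  obtain ⟨d, -, hd⟩ := Finset.exists_ne_zero_of_sum_ne_zero this
  exact ⟨(a, d), (mem_gEn M).2 ⟨ha, hd⟩⟩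

variable {M φ F}

lemma upd_track {v : ℕ → S × S × Bool} {d : ℕ → S}
    (hv : ∀ i, v (i + 1) = upd φ F (v i) (d i) (v (i + 1)).1) (i : ℕ) :
    φ (v (i + 1)).2.1 = if (v i).2.2 = true then φ (v (i + 1)).1
      else max (φ (v i).2.1) (φ (v (i + 1)).1) := by
  have h := congrArg (fun z => φ z.2.1) (hv i)
  simp only [upd] at h
  rw [h]
  by_cases hb : (v i).2.2 = true
  · rw [if_pos (Or.inl hb), if_pos hb]
  · by_cases h2 : φ (v i).2.1 ≤ φ (v (i + 1)).1
    · rw [if_pos (Or.inr h2), if_neg hb, max_eq_right h2]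
    · rw [if_neg (not_or.2 ⟨hb, h2⟩), if_neg hb, max_eq_left (by omega)]

lemma gpr_even {v : ℕ → S × S × Bool} {d : ℕ → S}
    (hv : ∀ i, v (i + 1) = upd φ F (v i) (d i) (v (i + 1)).1)
    (h : ∃ p, Even p ∧ LimMax (fun i => gpr φ (v i)) p) :
    (∃ᶠ i in Filter.atTop, (v i).2.2 = true) ∧ ∃ p, Even p ∧ LimMax (fun i => φ (v i).1) p := by
  obtain ⟨p, hp, hl⟩ := h
  by_cases hb : ∃ᶠ i in Filter.atTop, (v i).2.2 = true
  · refine ⟨hb, ?_⟩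
    obtain ⟨q, hq⟩ := exists_limMax φ (fun i => (v i).1)
    have := track_inf (b := fun i => (v i).2.2) (m := fun i => φ (v i).2.1) (upd_track hv) hb hq
    have e := hl.unique this
    subst e
    exact ⟨q, by simpa [Nat.even_add] using hp, hq⟩
  · have := track_fin (b := fun i => (v i).2.2) (m := fun i => φ (v i).2.1) hb
    have e := hl.unique this
    subst e
    exact absurd hp (by decide)

/-- A strategy with both properties yields a positional winning strategy in the game. -/
theorem posWin_of_strategy (hsink : ∀ t ∈ F, M.IsSink t) (σ : Strategy M) (s : S)
    (hS : M.Sure σ s (ParityObj φ)) (hV : val M σ F s σ.init = 1) :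
    PosWin (gsucc M φ F) (gpr φ) (gEn M) (s, s, true) := by
  rcases game_det (gsucc M φ F) (gpr φ) _ (gEn M) rfl (gEn_ne M) (s, s, true) with h | ⟨⟨K⟩⟩
  · exact h
  exfalso
  let dist : S → σ.Q → ℕ := fun s q => sInf {n | rN M σ F n s q ≠ 0}
  let J : K.X × σ.Q → Prop := fun z => K.I z.1 ∧ val M σ F (K.cur z.1).1 z.2 = 1
  have hact : ∀ z : K.X × σ.Q, ∃ a : Act × S, J z → σ.out z.2 (K.cur z.1).1 a.1 ≠ 0 ∧
      M.P (K.cur z.1).1 a.1 a.2 ≠ 0 ∧ ((K.cur z.1).1 ∉ F →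
        dist a.2 (σ.next z.2 (K.cur z.1).1) < dist (K.cur z.1).1 z.2) := by
    rintro ⟨x, q⟩
    by_cases hJ : J (x, q)
    swap
    · exact ⟨Classical.arbitrary _, fun h => absurd h hJ⟩
    set t := (K.cur x).1 with ht
    by_cases hF : t ∈ F
    · have : ∑ s', W M σ t q s' ≠ 0 := by rw [W_sum]; exact one_ne_zero
      obtain ⟨d, -, hd⟩ := Finset.exists_ne_zero_of_sum_ne_zero this
      obtain ⟨a, h1, h2⟩ := (W_ne_zero M σ).1 hd
      exact ⟨(a, d), fun _ => ⟨h1, h2, fun h => absurd hF h⟩⟩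
    · have hex : {n | rN M σ F n t q ≠ 0}.Nonempty := by
        by_contra hcon
        rw [Set.not_nonempty_iff_eq_empty, Set.eq_empty_iff_forall_notMem] at hcon
        have hv : val M σ F t q = 1 := hJ.2
        have : val M σ F t q = 0 := by
          simp only [val, ENNReal.iSup_eq_zero]
          intro n
          by_contra h
          exact hcon n h
        rw [this] at hv
        exact zero_ne_one hv
      obtain ⟨m, hm, d, hd, hr⟩ := val_path hF (Nat.sInf_mem hex)
      obtain ⟨a, h1, h2⟩ := (W_ne_zero M σ).1 hd
      refine ⟨(a, d), fun _ => ⟨h1, h2, fun _ => lt_of_le_of_lt (Nat.sInf_le hr) hm⟩⟩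
  choose act hact using hact
  let nx : K.X × σ.Q → K.X × σ.Q := fun z => (K.resp z.1 (act z), σ.next z.2 (K.cur z.1).1)
  let z : ℕ → K.X × σ.Q := fun i => nx^[i] (K.x0, σ.init)
  have hz : ∀ i, z (i + 1) = nx (z i) := fun i => Function.iterate_succ_apply' _ _ _
  have hen : ∀ y, J y → (K.cur y.1, act y) ∈ gEn M := fun y hy =>
    (mem_gEn M).2 ⟨σ.out_enabled _ _ _ (hact y hy).1, (hact y hy).2.1⟩
  have hW : ∀ y, J y → W M σ (K.cur y.1).1 y.2 (K.cur (nx y).1).1 ≠ 0 := fun y hy =>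
    (W_ne_zero M σ).2 ⟨(act y).1, (hact y hy).1, (K.legal _ _ hy.1 (hen y hy)).2.1⟩
  have hJ : ∀ i, J (z i) := by
    intro i
    induction i with
    | zero => exact ⟨K.I0, by simpa [z, K.cur0] using hV⟩
    | succ i ih =>
      rw [hz]
      exact ⟨(K.legal _ _ ih.1 (hen _ ih)).1, val_one_step hsink ih.2 (hW _ ih)⟩
  have hpath : (fun i => ((K.cur (z i).1).1, (z i).2)) ∈ PathsFrom (M.step σ) (s, σ.init) := by
    refine ⟨by simp [z, K.cur0], fun i => ?_⟩
    have := hW _ (hJ i)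
    rw [pos_iff_ne_zero]
    simp only [hz, MDP.step]
    rw [if_pos rfl]
    exact this
  have hpar := (parity_iff φ _).1 (hS hpath)
  obtain ⟨p, hp, hl⟩ := hpar
  have hv : ∀ i, K.cur (z (i + 1)).1 = upd φ F (K.cur (z i).1) (act (z i)).2
      (K.cur (z (i + 1)).1).1 := by
    intro i
    rw [hz]
    exact (K.legal _ _ (hJ i).1 (hen _ (hJ i))).2.2
  obtain ⟨p', hp', hl'⟩ := K.odd (fun i => (z i).1) (fun i => act (z i)) K.I0 fun i =>
    ⟨hen _ (hJ i), by rw [hz]⟩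
  by_cases hb : ∃ᶠ i in Filter.atTop, (K.cur (z i).1).2.2 = true
  · have := track_inf (b := fun i => (K.cur (z i).1).2.2) (m := fun i => φ (K.cur (z i).1).2.1)
      (c := fun i => φ (K.cur (z i).1).1)
      (upd_track (v := fun i => K.cur (z i).1) hv) hb hl
    have e := hl'.unique this
    subst e
    have : Odd p := by simpa [Nat.odd_add, Nat.not_odd_iff_even] using hp'
    exact Nat.not_even_iff_odd.2 this hp
  · rw [Filter.not_frequently, Filter.eventually_atTop] at hb
    obtain ⟨N, hN⟩ := hb
    have hnb : ∀ i, N ≤ i → (K.cur (z (i + 1)).1).1 = (act (z i)).2 ∧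
        (K.cur (z (i + 1)).1).1 ∉ F := by
      intro i hi
      have h1 := hN (i + 1) (by omega)
      rw [hv i] at h1
      simpa [upd] using h1
    have hdec : ∀ i, N + 1 ≤ i → dist (K.cur (z (i + 1)).1).1 (z (i + 1)).2 <
        dist (K.cur (z i).1).1 (z i).2 := by
      intro i hi
      have hF : (K.cur (z i).1).1 ∉ F := by
        have := (hnb (i - 1) (by omega)).2
        rwa [Nat.sub_add_cancel (by omega)] at this
      have h3 := (hact (z i) (hJ i)).2.2 hF
      rw [(hnb i (by omega)).1, hz]
      exact h3
    have hbound : ∀ k, dist (K.cur (z (N + 1 + k)).1).1 (z (N + 1 + k)).2 + k ≤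
        dist (K.cur (z (N + 1)).1).1 (z (N + 1)).2 := by
      intro k
      induction k with
      | zero => simp
      | succ k ih =>
        have := hdec (N + 1 + k) (by omega)
        have e : N + 1 + (k + 1) = N + 1 + k + 1 := by omega
        rw [e]
        omega
    have := hbound (dist (K.cur (z (N + 1)).1).1 (z (N + 1)).2 + 1)
    omega

/-! ### The base finite-memory strategy -/

variable (φ F) in
noncomputable def vert (f : S → S × S × Bool → Act × S) :
    Option (S × (S × S × Bool)) → S → S × (S × S × Bool)
  | none, s => (s, (s, s, true))
  | some x, s' => (x.1, upd φ F x.2 (f x.1 x.2).2 s')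

lemma vert_fst (f : S → S × S × Bool → Act × S) (q) (s : S) : (vert φ F f q s).2.1 = s := by
  cases q <;> rfl

variable (φ F) in
noncomputable def baseStrat (f : S → S × S × Bool → Act × S)
    (hf : ∀ s v, (v, f s v) ∈ gEn M) : Strategy M where
  Q := Option (S × (S × S × Bool))
  countable := inferInstance
  init := none
  next q s := some (vert φ F f q s)
  out q s a := if a = (f (vert φ F f q s).1 (vert φ F f q s).2).1 then 1 else 0
  out_sum q s := by simp
  out_enabled q s a h := by
    have ha : a = (f (vert φ F f q s).1 (vert φ F f q s).2).1 := by
      by_contra hne; simp [hne] at h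
    have := ((mem_gEn M).1 (hf (vert φ F f q s).1 (vert φ F f q s).2)).1
    rw [vert_fst] at this
    rw [ha]; exact this

lemma base_W (f : S → S × S × Bool → Act × S) (hf : ∀ s v, (v, f s v) ∈ gEn M) (s q s') :
    W M (baseStrat φ F f hf) s q s' = M.P s (f (vert φ F f q s).1 (vert φ F f q s).2).1 s' := by
  simp [W, baseStrat]

theorem base_good (f : S → S × S × Bool → Act × S) (hf : ∀ s v, (v, f s v) ∈ gEn M)
    (hw : ∀ s, ∀ w : ℕ → S × S × Bool, w 0 = (s, s, true) →
      (∀ i, w (i + 1) ∈ gsucc M φ F (w i) (f s (w i))) →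
      ∃ p, Even p ∧ LimMax (fun i => gpr φ (w i)) p) (s : S) :
    M.Sure (baseStrat φ F f hf) s (ParityObj φ) ∧
      val M (baseStrat φ F f hf) F s (baseStrat φ F f hf).init = 1 := by
  set σ := baseStrat φ F f hf with hσ
  constructor
  · intro ω hω
    obtain ⟨h0, hstep⟩ := hω
    refine (parity_iff φ _).2 ?_
    let u : ℕ → S × (S × S × Bool) := fun i => vert φ F f (ω i).2 (ω i).1
    have hpos : ∀ i, (ω (i + 1)).2 = some (u i) ∧ W M σ (ω i).1 (ω i).2 (ω (i + 1)).1 ≠ 0 := by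
      intro i
      have h := (hstep i).ne'
      simp only [MDP.step] at h
      split_ifs at h with h1
      · exact ⟨h1.symm, h⟩
      · exact absurd rfl h
    have hu : ∀ i, u (i + 1) = ((u i).1, upd φ F (u i).2 (f (u i).1 (u i).2).2 (ω (i + 1)).1) := by
      intro i
      change vert φ F f (ω (i + 1)).2 (ω (i + 1)).1 = _
      rw [(hpos i).1]; rfl
    have hu0 : u 0 = (s, (s, s, true)) := by
      simp only [u, h0]; rfl
    have hu1 : ∀ i, (u i).1 = s := by
      intro i
      induction i with
      | zero => rw [hu0]
      | succ i ih => rw [hu]; exact ih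
    have hfst : ∀ i, (u i).2.1 = (ω i).1 := fun i => vert_fst _ _ _
    have h2 : ∀ i, (u (i + 1)).2 ∈ gsucc M φ F (u i).2 (f s (u i).2) := by
      intro i
      have h3 := (hpos i).2
      rw [base_W] at h3
      change M.P (ω i).1 (f (u i).1 (u i).2).1 _ ≠ 0 at h3
      rw [hu1] at h3
      refine ⟨by rw [hfst, hfst]; exact h3, ?_⟩
      rw [hfst, hu, hu1]
    have hd : ∀ i, (u (i + 1)).2 = upd φ F (u i).2 (f s (u i).2).2 (u (i + 1)).2.1 :=
      fun i => (h2 i).2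
    have h4 := (gpr_even (v := fun i => (u i).2) hd (hw s (fun i => (u i).2) (by rw [hu0]) h2)).2
    simpa only [hfst] using h4
  · let Good : S × (S × S × Bool) → Prop := fun x => ∀ w : ℕ → S × S × Bool, w 0 = x.2 →
      (∀ i, w (i + 1) ∈ gsucc M φ F (w i) (f x.1 (w i))) →
      ∃ p, Even p ∧ LimMax (fun i => gpr φ (w i)) p
    have hGood : ∀ (s' : S) (q : σ.Q) (s'' : S), Good (vert φ F f q s') → W M σ s' q s'' ≠ 0 →
        Good (vert φ F f (σ.next q s') s'') := by
      intro s' q s'' hg hW w h0 hs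
      rw [base_W] at hW
      have := hg (fun i => Nat.casesOn i (vert φ F f q s').2 w) rfl (by
        intro i
        cases i with
        | zero =>
          change w 0 ∈ gsucc M φ F (vert φ F f q s').2 (f (vert φ F f q s').1 (vert φ F f q s').2)
          rw [h0]
          have e1 : (vert φ F f q s').2.1 = s' := vert_fst f q s'
          have e2 : (vert φ F f (σ.next q s') s'').2.1 = s'' := vert_fst _ _ _
          exact ⟨by rw [e1, e2]; exact hW, by rw [e2]; rfl⟩
        | succ i => exact hs i)
      obtain ⟨p, hp, hl⟩ := this
      rw [← LimMax.shift 1] at hl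
      exact ⟨p, hp, hl⟩
    let D : Set (S × σ.Q) := {x | Good (vert φ F f x.2 x.1)}
    haveI : Finite σ.Q := inferInstanceAs (Finite (Option (S × (S × S × Bool))))
    have hs0 : (s, σ.init) ∈ D := hw s
    obtain ⟨z0, hz0, hmin⟩ := Set.exists_min_image D (fun x => val M σ F x.1 x.2)
      (Set.toFinite D) ⟨_, hs0⟩
    have hm1 : val M σ F z0.1 z0.2 = 1 := by
      by_contra hne
      let ac : S × σ.Q → Act × S := fun z => f (vert φ F f z.2 z.1).1 (vert φ F f z.2 z.1).2
      let nx : S × σ.Q → S × σ.Q := fun z => ((ac z).2, σ.next z.2 z.1)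
      let z : ℕ → S × σ.Q := fun i => nx^[i] z0
      have hz : ∀ i, z (i + 1) = nx (z i) := fun i => Function.iterate_succ_apply' _ _ _
      have hWd : ∀ y : S × σ.Q, W M σ y.1 y.2 (ac y).2 ≠ 0 := by
        intro y
        rw [base_W]
        have := ((mem_gEn M).1 (hf (vert φ F f y.2 y.1).1 (vert φ F f y.2 y.1).2)).2
        have e : (vert φ F f y.2 y.1).2.1 = y.1 := vert_fst _ _ _
        rwa [e] at this
      have hinv : ∀ i, z i ∈ D ∧ val M σ F (z i).1 (z i).2 = val M σ F z0.1 z0.2 := by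
        intro i
        induction i with
        | zero => exact ⟨hz0, rfl⟩
        | succ i ih =>
          have hnF : (z i).1 ∉ F := by
            intro h
            have := ih.2
            rw [val_F h] at this
            exact hne this.symm
          rw [hz]
          refine ⟨hGood _ _ _ ih.1 (hWd _), ?_⟩
          have h5 := ih.2
          rw [val_step hnF] at h5
          refine wavg_eq _ (fun s' => val M σ F s' (σ.next (z i).2 (z i).1)) _
            (ne_top_of_le_ne_top ENNReal.one_ne_top (val_le_one _ _)) (W_sum M σ (z i).1 (z i).2)
            (Or.inr fun s' hs' => hmin (s', σ.next (z i).2 (z i).1) (hGood _ _ _ ih.1 hs')) h5 _ (hWd _)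
      have hnF : ∀ i, (z i).1 ∉ F := by
        intro i h
        have := (hinv i).2
        rw [val_F h] at this
        exact hne this.symm
      let u : ℕ → S × (S × S × Bool) := fun i => vert φ F f (z i).2 (z i).1
      have hu : ∀ i, u (i + 1) = ((u i).1, upd φ F (u i).2 (f (u i).1 (u i).2).2 (z (i + 1)).1) := by
        intro i
        change vert φ F f (z (i + 1)).2 (z (i + 1)).1 = _
        rw [hz]; rfl
      have hfst : ∀ i, (u i).2.1 = (z i).1 := fun i => vert_fst _ _ _
      have hu1 : ∀ i, (u i).1 = (u 0).1 := by
        intro i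
        induction i with
        | zero => rfl
        | succ i ih => rw [hu]; exact ih
      have h2 : ∀ i, (u (i + 1)).2 ∈ gsucc M φ F (u i).2 (f (u 0).1 (u i).2) := by
        intro i
        have h3 := hWd (z i)
        rw [base_W] at h3
        refine ⟨?_, by rw [hfst, hu, hu1]⟩
        rw [hfst, hfst, hz, ← hu1 i]
        exact h3
      have hd : ∀ i, (u (i + 1)).2 = upd φ F (u i).2 (f (u 0).1 (u i).2).2 (u (i + 1)).2.1 :=
        fun i => (h2 i).2
      have h4 := (gpr_even (v := fun i => (u i).2) hd (hz0 (fun i => (u i).2) rfl h2)).1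
      rw [Filter.frequently_atTop] at h4
      obtain ⟨j, hj, hb⟩ := h4 1
      obtain ⟨i, rfl⟩ : ∃ i, j = i + 1 := ⟨j - 1, by omega⟩
      rw [hu] at hb
      simp only [upd, decide_eq_true_eq] at hb
      rcases hb with hb | hb
      · apply hb; rw [hz]
      · exact hnF _ hb
    refine le_antisymm (val_le_one _ _) ?_
    rw [← hm1]
    exact hmin _ hs0

/-! ### Prepending one step -/

noncomputable def preStrat (o : S → Act → ℝ≥0∞) (ho : ∀ s, ∑ a, o s a = 1)
    (he : ∀ s a, o s a ≠ 0 → (∑ s', M.P s a s') = 1) (ρ : S → Strategy M) : Strategy M where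
  Q := Option (Σ s, (ρ s).Q)
  countable := by
    haveI := fun s => (ρ s).countable
    infer_instance
  init := none
  next q s := match q with
    | none => some ⟨s, (ρ s).init⟩
    | some x => some ⟨x.1, (ρ x.1).next x.2 s⟩
  out q s a := match q with
    | none => o s a
    | some x => (ρ x.1).out x.2 s a
  out_sum q s := by
    cases q with
    | none => exact ho s
    | some x => exact (ρ x.1).out_sum x.2 s
  out_enabled q s a := by
    cases q with
    | none => exact he s a
    | some x => exact (ρ x.1).out_enabled x.2 s a

section Pre
variable (o : S → Act → ℝ≥0∞) (ho : ∀ s, ∑ a, o s a = 1)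
    (he : ∀ s a, o s a ≠ 0 → (∑ s', M.P s a s') = 1) (ρ : S → Strategy M)

lemma pre_rN (G : Set S) (n : ℕ) : ∀ (s' t : S) (q : (ρ t).Q),
    rN M (preStrat o ho he ρ) G n s' (some ⟨t, q⟩) = rN M (ρ t) G n s' q := by
  induction n with
  | zero => intro s' t q; rfl
  | succ n ih =>
    intro s' t q
    simp only [rN]
    split_ifs
    · rfl
    · refine Finset.sum_congr rfl fun x _ => ?_
      congr 1
      exact ih x t _

lemma pre_val (G : Set S) (s' t : S) (q : (ρ t).Q) :
    val M (preStrat o ho he ρ) G s' (some ⟨t, q⟩) = val M (ρ t) G s' q := by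
  simp only [val, pre_rN]

lemma pre_val_init (s : S) (h : ∀ s', val M (ρ s) F s' (ρ s).init = 1) :
    val M (preStrat o ho he ρ) F s (preStrat o ho he ρ).init = 1 := by
  by_cases hs : s ∈ F
  · exact val_F hs
  · rw [val_step hs, ← W_sum M (preStrat o ho he ρ) s (preStrat o ho he ρ).init]
    refine Finset.sum_congr rfl fun s' _ => ?_
    have : val M (preStrat o ho he ρ) F s' ((preStrat o ho he ρ).next (preStrat o ho he ρ).init s) = 1 :=
      (pre_val o ho he ρ F s' s (ρ s).init).trans (h s')
    rw [this, mul_one]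

lemma pre_sure (s : S) (h : ∀ s', M.Sure (ρ s) s' (ParityObj φ)) :
    M.Sure (preStrat o ho he ρ) s (ParityObj φ) := by
  intro ω hω
  obtain ⟨h0, hstep⟩ := hω
  refine (parity_iff φ _).2 ?_
  have hq : ∀ i, ∃ q : (ρ s).Q, (ω (i + 1)).2 = some ⟨s, q⟩ := by
    intro i
    induction i with
    | zero =>
      have h1 := (hstep 0).ne'
      simp only [MDP.step] at h1
      split_ifs at h1 with h2
      · refine ⟨(ρ s).init, ?_⟩
        rw [← h2, h0]; rfl
      · exact absurd rfl h1
    | succ i ih =>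
      obtain ⟨q, hq⟩ := ih
      have h1 := (hstep (i + 1)).ne'
      simp only [MDP.step] at h1
      split_ifs at h1 with h2
      · refine ⟨(ρ s).next q (ω (i + 1)).1, ?_⟩
        rw [← h2, hq]; rfl
      · exact absurd rfl h1
  choose q hq using hq
  have hp : (fun i => ((ω (i + 1)).1, q i)) ∈ PathsFrom (M.step (ρ s)) ((ω 1).1, (ρ s).init) := by
    refine ⟨?_, fun i => ?_⟩
    · have h1 := (hstep 0).ne'
      simp only [MDP.step] at h1
      split_ifs at h1 with h2
      · rw [hq 0, h0] at h2
        have h3 : (some ⟨s, (ρ s).init⟩ : Option (Σ s, (ρ s).Q)) = some ⟨s, q 0⟩ := h2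
        simp only [Option.some.injEq, Sigma.mk.injEq, heq_eq_eq, true_and] at h3
        simp [h3]
      · exact absurd rfl h1
    · have h1 := (hstep (i + 1)).ne'
      simp only [MDP.step] at h1
      split_ifs at h1 with h2
      · rw [hq i, hq (i + 1)] at h2
        have h3 : (some ⟨s, (ρ s).next (q i) (ω (i + 1)).1⟩ : Option (Σ s, (ρ s).Q)) =
          some ⟨s, q (i + 1)⟩ := h2
        simp only [Option.some.injEq, Sigma.mk.injEq, heq_eq_eq, true_and] at h3
        rw [hq i] at h1
        rw [pos_iff_ne_zero]
        simp only [MDP.step]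
        rw [if_pos h3]
        exact h1
      · exact absurd rfl h1
  obtain ⟨p, hp, hl⟩ := (parity_iff φ _).1 (h _ hp)
  exact ⟨p, hp, (LimMax.shift 1).1 hl⟩

end Pre

theorem switch_exists (ρ0 : Strategy M) (hfin : Finite ρ0.Q)
    (h0 : ∀ s, M.Sure ρ0 s (ParityObj φ) ∧ val M ρ0 F s ρ0.init = 1) (τ : Strategy M) (N : ℕ) :
    ∀ q : τ.Q, ∃ σ : Strategy M, Finite σ.Q ∧ ∀ s, M.Sure σ s (ParityObj φ) ∧
      val M σ F s σ.init = 1 ∧ ∀ G : Set S, rN M σ G N s σ.init = rN M τ G N s q := by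
  induction N with
  | zero => exact fun q => ⟨ρ0, hfin, fun s => ⟨(h0 s).1, (h0 s).2, fun G => rfl⟩⟩
  | succ N ih =>
    intro q
    choose σ' hfin' hσ' using ih
    let ρ : S → Strategy M := fun s => σ' (τ.next q s)
    refine ⟨preStrat (τ.out q) (τ.out_sum q) (τ.out_enabled q) ρ, ?_, fun s =>
      ⟨pre_sure _ _ _ _ s fun s' => (hσ' _ s').1, pre_val_init _ _ _ _ s fun s' => (hσ' _ s').2.1,
        fun G => ?_⟩⟩
    · haveI : ∀ s, Finite (ρ s).Q := fun s => hfin' _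
      exact inferInstanceAs (Finite (Option (Σ s, (ρ s).Q)))
    · simp only [rN]
      split_ifs
      · rfl
      · refine Finset.sum_congr rfl fun x _ => ?_
        congr 1
        refine (pre_rN (τ.out q) (τ.out_sum q) (τ.out_enabled q) ρ G N x s (ρ s).init).trans ?_
        exact (hσ' _ x).2.2 G

end MGame

end SwProof

/-- switching lemma from the proof of Lemma 8: for every strategy `τ` and
`ε > 0` there is a finite-memory strategy that surely satisfies the parity objective,
almost-surely reaches `F`, and `ε`-approximates the reachability probabilities of `τ`. -/
theorem switching_strategy_approximation
    {S Act : Type} [Fintype S] [Nonempty S] [Fintype Act] [Nonempty Act] {n : ℕ}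
    (M : MDP S Act) (φ : S → ℕ) (F : Fin n → Set S)
    (hsink : ∀ t ∈ ⋃ i, F i, M.IsSink t)
    (hsure : ∀ s' : S, ∃ σ' : Strategy M, M.Sure σ' s' (ParityObj φ) ∧
      1 ≤ M.Pr σ' s' (ReachObj (⋃ i, F i)))
    (s : S) (τ : Strategy M) (ε : ℝ) (hε : 0 < ε) :
    ∃ σ : Strategy M, σ.FiniteMemory ∧ M.Sure σ s (ParityObj φ) ∧
      1 ≤ M.Pr σ s (ReachObj (⋃ i, F i)) ∧
      ∀ i, M.Pr τ s (ReachObj (F i)) - ENNReal.ofReal ε ≤ M.Pr σ s (ReachObj (F i)) := by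
  set U := ⋃ i, F i with hU
  have hpos : ∀ s', SwProof.PosWin (SwProof.gsucc M φ U) (SwProof.gpr φ) (SwProof.gEn M)
      (s', s', true) := by
    intro s'
    obtain ⟨σ', h1, h2⟩ := hsure s'
    rw [SwProof.Pr_eq] at h2
    exact SwProof.posWin_of_strategy hsink σ' s' h1 (le_antisymm (SwProof.val_le_one _ _) h2)
  choose f hf hw using hpos
  have hbase := SwProof.base_good f hf hw
  have hN : ∀ i, ∃ N, M.Pr τ s (ReachObj (F i)) - ENNReal.ofReal ε ≤
      SwProof.rN M τ (F i) N s τ.init := by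
    intro i
    rw [SwProof.Pr_eq]
    by_cases h0 : SwProof.val M τ (F i) s τ.init = 0
    · exact ⟨0, by simp [h0]⟩
    · have hlt : SwProof.val M τ (F i) s τ.init - ENNReal.ofReal ε <
          SwProof.val M τ (F i) s τ.init :=
        ENNReal.sub_lt_self (ne_top_of_le_ne_top ENNReal.one_ne_top (SwProof.val_le_one _ _)) h0
          (by simpa using hε)
      obtain ⟨N, hN⟩ := lt_iSup_iff.1 (show _ < ⨆ n, SwProof.rN M τ (F i) n s τ.init from hlt)
      exact ⟨N, hN.le⟩
  choose N hN using hN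
  obtain ⟨σ, hfin, hσ⟩ := SwProof.switch_exists (SwProof.baseStrat φ U f hf)
    (inferInstanceAs (Finite (Option (S × (S × S × Bool))))) hbase τ (Finset.univ.sup N) τ.init
  obtain ⟨h1, h2, h3⟩ := hσ s
  refine ⟨σ, hfin, h1, ?_, fun i => ?_⟩
  · rw [SwProof.Pr_eq, h2]
  · refine (hN i).trans ?_
    refine (SwProof.rN_mono s τ.init (Finset.le_sup (Finset.mem_univ i))).trans ?_
    simp only
    rw [← h3 (F i), SwProof.Pr_eq]
    exact le_iSup (fun n => SwProof.rN M σ (F i) n s σ.init) _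
end

section
/- Let V ⊆ ℝ^n be an affine subspace of dimension m, let y^1, …, y^{m+1} ∈ V be affinely independent, and let x be a point in the interior, relative to V, of the convex hull of {y^1, …, y^{m+1}}. Then there exists ε > 0 such that for all points z^1, …, z^{m+1} ∈ V with ‖y^j − z^j‖ ≤ ε for all j ∈ {1,…,m+1}, the point x belongs to the convex hull of {z^1, …, z^{m+1}}. (Perturbation-stability claim from the proof of Lemma 8, cf. Figure 4.) -/
open MeasureTheory ENNReal
open scoped Classical

/-- perturbation stability, cf. Figure 4: if `x` lies in the interior,
relative to an `m`-dimensional affine subspace `V`, of the convex hull of `m+1` affinely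
independent points `y j ∈ V`, then for some `ε > 0`, `x` remains in the convex hull of any
points `z j ∈ V` with `‖y j − z j‖ ≤ ε`. -/
theorem simplex_interior_perturbation_stable
    {n m : ℕ} (V : AffineSubspace ℝ (EuclideanSpace ℝ (Fin n)))
    (hV : Module.finrank ℝ V.direction = m)
    (y : Fin (m + 1) → EuclideanSpace ℝ (Fin n)) (hy : ∀ j, y j ∈ V)
    (hind : AffineIndependent ℝ y)
    (x : EuclideanSpace ℝ (Fin n)) (hxV : x ∈ V)
    (hx : (⟨x, hxV⟩ : V) ∈ interior
      ((fun z : V => (z : EuclideanSpace ℝ (Fin n))) ⁻¹'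
        (convexHull ℝ (Set.range y)))) :
    ∃ ε > (0 : ℝ), ∀ z : Fin (m + 1) → EuclideanSpace ℝ (Fin n),
      (∀ j, z j ∈ V) → (∀ j, ‖y j - z j‖ ≤ ε) →
      x ∈ convexHull ℝ (Set.range z) := by
  rw [mem_interior_iff_mem_nhds, Metric.mem_nhds_iff] at hx
  obtain ⟨r, hr, hball⟩ := hx
  refine ⟨r / 2, by positivity, fun z hz hyz => ?_⟩
  by_contra hxz
  have hsub : convexHull ℝ (Set.range z) ⊆ (V : Set (EuclideanSpace ℝ (Fin n))) := by
    apply convexHull_min _ V.convex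
    rintro _ ⟨j, rfl⟩
    exact hz j
  have hcomp : IsComplete (convexHull ℝ (Set.range z)) :=
    ((Set.finite_range z).isCompact_convexHull ℝ).isComplete
  have hne : (convexHull ℝ (Set.range z)).Nonempty :=
    ⟨z 0, subset_convexHull ℝ _ ⟨0, rfl⟩⟩
  obtain ⟨p, hp, hpx⟩ :=
    exists_norm_eq_iInf_of_complete_convex hne hcomp (convex_convexHull ℝ _) x
  rw [norm_eq_iInf_iff_real_inner_le_zero (convex_convexHull ℝ _) hp] at hpx
  have hu0 : x - p ≠ 0 := by
    intro h
    rw [sub_eq_zero] at h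
    exact hxz (h ▸ hp)
  have hu : 0 < ‖x - p‖ := norm_pos_iff.mpr hu0
  have hdir : x - p ∈ V.direction := AffineSubspace.vsub_mem_direction hxV (hsub hp)
  have hwV : (r / 2 / ‖x - p‖) • (x - p) + x ∈ V :=
    AffineSubspace.vadd_mem_of_mem_direction (V.direction.smul_mem _ hdir) hxV
  have hw : (r / 2 / ‖x - p‖) • (x - p) + x ∈ convexHull ℝ (Set.range y) := by
    have : (⟨_, hwV⟩ : V) ∈ Metric.ball (⟨x, hxV⟩ : V) r := by
      rw [Metric.mem_ball, Subtype.dist_eq, dist_eq_norm, add_sub_cancel_right, norm_smul,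
        Real.norm_of_nonneg (by positivity), div_mul_cancel₀ _ hu.ne']
      linarith
    exact hball this
  have hhalf : convexHull ℝ (Set.range y) ⊆
      {w | innerSL ℝ (x - p) w ≤ inner ℝ (x - p) p + r / 2 * ‖x - p‖} := by
    apply convexHull_min _ (convex_halfSpace_le (innerSL ℝ (x - p)).isLinear _)
    rintro _ ⟨j, rfl⟩
    have h1 := hpx (z j) (subset_convexHull ℝ _ ⟨j, rfl⟩)
    have h2 := real_inner_le_norm (x - p) (y j - z j)
    have h3 := mul_le_mul_of_nonneg_left (hyz j) hu.le
    rw [inner_sub_right] at h1 h2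
    change inner ℝ (x - p) (y j) ≤ inner ℝ (x - p) p + r / 2 * ‖x - p‖
    linarith
  have h := hhalf hw
  have h4 : inner ℝ (x - p) x = inner ℝ (x - p) p + ‖x - p‖ ^ 2 := by
    rw [← real_inner_self_eq_norm_sq, inner_sub_right (x - p) x p]
    ring
  simp only [Set.mem_ofPred_eq, innerSL_apply_apply] at h
  rw [inner_add_right, inner_smul_right, real_inner_self_eq_norm_sq, h4] at h
  have h5 : r / 2 / ‖x - p‖ * ‖x - p‖ ^ 2 = r / 2 * ‖x - p‖ := by
    field_simp
  rw [h5] at h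
  nlinarith [pow_pos hu 2]
end
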